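/- Let A be a real n×m matrix, v*, μ ∈ ℝⁿ, f(φ) = (1/2)‖v* − Aφ − μ‖², L = ‖AᵀA‖, and let lo ≤ hi in ℝᵐ with q* ∈ [lo, hi]. Let (Ω, ℱ, P) be a probability space with sub-σ-algebra 𝒢, let q be a 𝒢-measurable random vector taking values in [lo, hi], let ζ be a random vector in ℝᵐ with E[‖ζ‖²] < ∞ and E[ζ | 𝒢] = 0 almost surely, let γ > 0, and set q⁺ = Π_{[lo,hi]}(q − γ(∇f(q) + ζ)). Then, almost surely, E[‖q⁺ − q*‖² | 𝒢] ≤ (1 + 2L²γ²)‖q − q*‖² − 2γ(f(q) − f(q*)) + 2γ² E[‖∇f(q*) + ζ‖² | 𝒢]. -/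

import Mathlib

open Matrix MeasureTheory

/-- Clamping to an interval does not increase the distance to a point of the interval. -/
lemma abs_clamp_sub_le {a b s : ℝ} (x : ℝ) (hs : a ≤ s ∧ s ≤ b) :
    |max a (min b x) - s| ≤ |x - s| := by
  have h := (abs_max_sub_max_le_abs (min b x) (min b s) a).trans
    (abs_min_sub_min_le_max b x b s)
  rwa [min_eq_right hs.2, max_eq_left hs.1, sub_self, abs_zero,
    max_eq_right (abs_nonneg (x - s)), max_comm] at h

lemma EuclideanSpace.norm_le_norm_of_abs_le {ι : Type*} [Fintype ι] {x y : EuclideanSpace ℝ ι}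
    (h : ∀ i, |x i| ≤ |y i|) : ‖x‖ ≤ ‖y‖ := by
  rw [EuclideanSpace.norm_eq, EuclideanSpace.norm_eq]
  exact Real.sqrt_le_sqrt (Finset.sum_le_sum fun i _ => pow_le_pow_left₀ (abs_nonneg _) (h i) 2)

lemma EuclideanSpace.norm_sub_le_of_mem_box {ι : Type*} [Fintype ι]
    {lo hi x y : EuclideanSpace ℝ ι} (hx : ∀ i, lo i ≤ x i ∧ x i ≤ hi i)
    (hy : ∀ i, lo i ≤ y i ∧ y i ≤ hi i) : ‖x - y‖ ≤ ‖hi - lo‖ := by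
  refine norm_le_norm_of_abs_le fun i => ?_
  obtain ⟨h1, h2⟩ := hx i
  obtain ⟨h3, h4⟩ := hy i
  simp only [PiLp.sub_apply]
  rw [abs_of_nonneg (by linarith : (0 : ℝ) ≤ hi i - lo i), abs_le]
  constructor <;> linarith

lemma Matrix.inner_toEuclideanLin_transpose {m n : Type*} [Fintype m] [Fintype n]
    [DecidableEq m] [DecidableEq n] (A : Matrix n m ℝ)
    (x : EuclideanSpace ℝ m) (y : EuclideanSpace ℝ n) :
    inner ℝ x (toEuclideanLin Aᵀ y) = inner ℝ (toEuclideanLin A x) y := by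
  rw [← conjTranspose_eq_transpose_of_trivial, toEuclideanLin_conjTranspose_eq_adjoint,
    LinearMap.adjoint_inner_right]

/-- First-order convexity inequality for the quadratic cost. -/
lemma half_norm_sq_sub_le_inner {m n : Type*} [Fintype m] [Fintype n]
    [DecidableEq m] [DecidableEq n] (A : Matrix n m ℝ) (v μ : EuclideanSpace ℝ n)
    (x y : EuclideanSpace ℝ m) :
    (1 / 2) * ‖v - toEuclideanLin A x - μ‖ ^ 2 - (1 / 2) * ‖v - toEuclideanLin A y - μ‖ ^ 2
      ≤ inner ℝ (x - y) (-(toEuclideanLin Aᵀ (v - toEuclideanLin A x - μ))) := by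
  rw [inner_neg_right, inner_toEuclideanLin_transpose, map_sub]
  set r := v - toEuclideanLin A x - μ
  set d := toEuclideanLin A x - toEuclideanLin A y with hd
  have hy : v - toEuclideanLin A y - μ = d + r := by simp only [r, hd]; abel
  rw [hy, norm_add_sq_real]
  nlinarith [sq_nonneg ‖d‖]

/-- The gradient of the quadratic cost is Lipschitz with constant `‖AᵀA‖`. -/
lemma norm_quadratic_gradient_sub_le {m n : Type*} [Fintype m] [Fintype n]
    [DecidableEq m] [DecidableEq n] (A : Matrix n m ℝ) (v μ : EuclideanSpace ℝ n)
    (x y : EuclideanSpace ℝ m) :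
    ‖-(toEuclideanLin Aᵀ (v - toEuclideanLin A x - μ))
        - -(toEuclideanLin Aᵀ (v - toEuclideanLin A y - μ))‖
      ≤ ‖LinearMap.toContinuousLinearMap (toEuclideanLin (Aᵀ * A))‖ * ‖x - y‖ := by
  have h : -(toEuclideanLin Aᵀ (v - toEuclideanLin A x - μ))
        - -(toEuclideanLin Aᵀ (v - toEuclideanLin A y - μ))
      = LinearMap.toContinuousLinearMap (toEuclideanLin (Aᵀ * A)) (x - y) := by
    rw [LinearMap.coe_toContinuousLinearMap', toEuclideanLin, toLpLin_mul_same,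
      LinearMap.comp_apply]
    simp only [map_sub]
    abel
  rw [h]
  exact ContinuousLinearMap.le_opNorm _ _

/-- One step of perturbed gradient descent: expansion of the squared distance, using a
first-order lower bound `c` and a Lipschitz bound on the gradient. -/
lemma norm_sq_descent_step_le {E : Type*} [NormedAddCommGroup E] [InnerProductSpace ℝ E]
    {x y g g' : E} (z : E) {c L γ : ℝ} (hγ : 0 < γ) (hc : c ≤ inner ℝ (x - y) g)
    (hL : ‖g - g'‖ ≤ L * ‖x - y‖) :
    ‖x - γ • (g + z) - y‖ ^ 2 ≤ (1 + 2 * L ^ 2 * γ ^ 2) * ‖x - y‖ ^ 2 - 2 * γ * c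
      - 2 * γ * inner ℝ (x - y) z + 2 * γ ^ 2 * ‖g' + z‖ ^ 2 := by
  have hexp : ‖x - γ • (g + z) - y‖ ^ 2
      = ‖x - y‖ ^ 2 - 2 * γ * (inner ℝ (x - y) g + inner ℝ (x - y) z)
        + γ ^ 2 * ‖g + z‖ ^ 2 := by
    rw [sub_right_comm, norm_sub_sq_real, inner_smul_right, inner_add_right, norm_smul,
      Real.norm_eq_abs, mul_pow, sq_abs]
    ring
  have hsplit : ‖g + z‖ ^ 2 ≤ 2 * ‖g - g'‖ ^ 2 + 2 * ‖g' + z‖ ^ 2 := by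
    have h : ‖g + z‖ ≤ ‖g - g'‖ + ‖g' + z‖ := by
      simpa only [← add_assoc, sub_add_cancel] using norm_add_le (g - g') (g' + z)
    nlinarith [pow_le_pow_left₀ (norm_nonneg _) h 2, sq_nonneg (‖g - g'‖ - ‖g' + z‖)]
  have hL2 : ‖g - g'‖ ^ 2 ≤ L ^ 2 * ‖x - y‖ ^ 2 := by
    rw [← mul_pow]
    exact pow_le_pow_left₀ (norm_nonneg _) hL 2
  have h1 : γ ^ 2 * ‖g + z‖ ^ 2
      ≤ γ ^ 2 * (2 * (L ^ 2 * ‖x - y‖ ^ 2) + 2 * ‖g' + z‖ ^ 2) := by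
    gcongr
    linarith
  have h2 : γ * c ≤ γ * inner ℝ (x - y) g := by gcongr
  rw [hexp]
  linarith

/-- The key recursive inequality (26) in the proof of Proposition 1: for the
quadratic cost `f(φ) = (1/2)‖v* − Aφ − μ‖²` with gradient
`∇f(φ) = −Aᵀ(v* − Aφ − μ)` and `L = ‖AᵀA‖`, a sub-σ-algebra `𝒢`,
a `𝒢`-measurable `q` with values in the box `[lo, hi]`, noise `ζ` with
`E[‖ζ‖²] < ∞` and `E[ζ | 𝒢] = 0` a.s., `γ > 0`, and
`q⁺ = Π_{[lo,hi]}(q − γ(∇f(q) + ζ))`, one has, almost surely,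
`E[‖q⁺ − q*‖² | 𝒢] ≤ (1 + 2L²γ²)‖q − q*‖² − 2γ(f(q) − f(q*)) + 2γ² E[‖∇f(q*) + ζ‖² | 𝒢]`. -/
theorem stmt4 {n m : ℕ}
    (A : Matrix (Fin n) (Fin m) ℝ) (vstar μ : EuclideanSpace ℝ (Fin n))
    (f : EuclideanSpace ℝ (Fin m) → ℝ)
    (hf : ∀ φ, f φ = (1/2) * ‖vstar - Matrix.toEuclideanLin A φ - μ‖^2)
    (gradf : EuclideanSpace ℝ (Fin m) → EuclideanSpace ℝ (Fin m))
    (hgradf : ∀ φ, gradf φ = -(Matrix.toEuclideanLin Aᵀ (vstar - Matrix.toEuclideanLin A φ - μ)))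
    (L : ℝ)
    (hL : L = ‖LinearMap.toContinuousLinearMap (Matrix.toEuclideanLin (Aᵀ * A))‖)
    (lo hi : EuclideanSpace ℝ (Fin m)) (hlohi : ∀ i, lo i ≤ hi i)
    (qstar : EuclideanSpace ℝ (Fin m))
    (hqstar : ∀ i, lo i ≤ qstar i ∧ qstar i ≤ hi i)
    {Ω : Type*} {m0 : MeasurableSpace Ω} (P : Measure Ω) [IsProbabilityMeasure P]
    (G : MeasurableSpace Ω) (hG : G ≤ m0)
    (q : Ω → EuclideanSpace ℝ (Fin m)) (hq_meas : Measurable[G] q)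
    (hq_box : ∀ ω i, lo i ≤ q ω i ∧ q ω i ≤ hi i)
    (ζ : Ω → EuclideanSpace ℝ (Fin m))
    (hζ_int : Integrable ζ P)
    (hζ_sq_int : Integrable (fun ω => ‖ζ ω‖^2) P)
    (hζ_mean : P[ζ | G] =ᵐ[P] 0)
    (γ : ℝ) (hγ : 0 < γ)
    (qplus : Ω → EuclideanSpace ℝ (Fin m))
    (hqplus : ∀ ω i, qplus ω i
      = max (lo i) (min (hi i) ((q ω - γ • (gradf (q ω) + ζ ω)) i))) :
    ∀ᵐ ω ∂P, (P[fun ω' => ‖qplus ω' - qstar‖^2 | G]) ω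
      ≤ (1 + 2 * L^2 * γ^2) * ‖q ω - qstar‖^2 - 2 * γ * (f (q ω) - f qstar)
        + 2 * γ^2 * (P[fun ω' => ‖gradf qstar + ζ ω'‖^2 | G]) ω := by
  have hq : Measurable[m0] q := hq_meas.mono hG le_rfl
  have hcont_f : Continuous f := by
    rw [funext hf]
    have := (toEuclideanLin A).continuous_of_finiteDimensional
    fun_prop
  have hcont_g : Continuous gradf := by
    rw [funext hgradf]
    have := (toEuclideanLin A).continuous_of_finiteDimensional
    have := (toEuclideanLin Aᵀ).continuous_of_finiteDimensional
    fun_prop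
  set D := ‖hi - lo‖
  have hqD : ∀ ω, ‖q ω - qstar‖ ≤ D := fun ω =>
    EuclideanSpace.norm_sub_le_of_mem_box (hq_box ω) hqstar
  have hplusD : ∀ ω, ‖qplus ω - qstar‖ ≤ D := fun ω =>
    EuclideanSpace.norm_sub_le_of_mem_box
      (fun i => by
        rw [hqplus]
        exact ⟨le_max_left _ _, max_le (hlohi i) (min_le_left _ _)⟩) hqstar
  have hqplus_meas : AEStronglyMeasurable[m0] qplus P := by
    have hstep : AEMeasurable[m0] (fun ω => q ω - γ • (gradf (q ω) + ζ ω)) P :=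
      hq.aemeasurable.sub
        (((hcont_g.measurable.comp hq).aemeasurable.add hζ_int.aemeasurable).const_smul γ)
    have hclamp : Continuous fun x : EuclideanSpace ℝ (Fin m) =>
        WithLp.toLp 2 fun i => max (lo i) (min (hi i) (x i)) := by
      fun_prop
    have heq : qplus = fun ω => WithLp.toLp 2 fun i =>
        max (lo i) (min (hi i) ((q ω - γ • (gradf (q ω) + ζ ω)) i)) := by
      funext ω
      ext i
      exact hqplus ω i
    rw [heq]
    exact hclamp.comp_aestronglyMeasurable hstep.aestronglyMeasurable
  have hint_plus : Integrable (fun ω => ‖qplus ω - qstar‖ ^ 2) P := by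
    refine Integrable.of_bound
      ((hqplus_meas.sub aestronglyMeasurable_const).norm.pow 2) (D ^ 2) (ae_of_all _ fun ω => ?_)
    rw [Real.norm_eq_abs, abs_of_nonneg (sq_nonneg _)]
    exact pow_le_pow_left₀ (norm_nonneg _) (hplusD ω) 2
  set B : Ω → ℝ := fun ω =>
    (1 + 2 * L ^ 2 * γ ^ 2) * ‖q ω - qstar‖ ^ 2 - 2 * γ * (f (q ω) - f qstar) with hB
  have hB_meas : StronglyMeasurable[G] B := by
    have hcont : Continuous fun x => (1 + 2 * L ^ 2 * γ ^ 2) * ‖x - qstar‖ ^ 2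
        - 2 * γ * (f x - f qstar) := by fun_prop
    exact hcont.comp_stronglyMeasurable hq_meas.stronglyMeasurable
  have hB_int : Integrable B P := by
    have hcont : Continuous fun x => (1 + 2 * L ^ 2 * γ ^ 2) * ‖x - qstar‖ ^ 2
        - 2 * γ * (f x - f qstar) := by fun_prop
    obtain ⟨C, hC⟩ := (isCompact_closedBall qstar D).exists_bound_of_continuousOn
      hcont.continuousOn
    refine Integrable.of_bound (hB_meas.mono hG).aestronglyMeasurable C
      (ae_of_all _ fun ω => hC _ ?_)
    rw [mem_closedBall_iff_norm]
    exact hqD ω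
  have hq_sub : StronglyMeasurable[G] fun ω => q ω - qstar :=
    hq_meas.stronglyMeasurable.sub stronglyMeasurable_const
  have hI_int : Integrable (fun ω => (inner ℝ (q ω - qstar) (ζ ω) : ℝ)) P := by
    refine (hζ_int.norm.const_mul D).mono'
      ((hq_sub.mono hG).aestronglyMeasurable.inner hζ_int.aestronglyMeasurable)
      (ae_of_all _ fun ω => (norm_inner_le_norm _ _).trans ?_)
    gcongr
    exact hqD ω
  have hI_zero : P[fun ω => (inner ℝ (q ω - qstar) (ζ ω) : ℝ) | G] =ᵐ[P] 0 := by
    refine (condExp_bilin_of_stronglyMeasurable_left (innerSL ℝ) hq_sub hI_int hζ_int).trans ?_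
    filter_upwards [hζ_mean] with ω hω
    simp [hω]
  have hN_int : Integrable (fun ω => ‖gradf qstar + ζ ω‖ ^ 2) P := by
    have hζ2 : MemLp ζ 2 P :=
      (memLp_two_iff_integrable_sq_norm hζ_int.aestronglyMeasurable).2 hζ_sq_int
    exact ((memLp_const (gradf qstar)).add hζ2).integrable_norm_pow two_ne_zero
  have hpt : ∀ ω, ‖qplus ω - qstar‖ ^ 2 ≤ (B + ((-(2 * γ)) • (fun ω' =>
      (inner ℝ (q ω' - qstar) (ζ ω') : ℝ)) + (2 * γ ^ 2) • fun ω' =>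
        ‖gradf qstar + ζ ω'‖ ^ 2)) ω := by
    intro ω
    have hproj : ‖qplus ω - qstar‖ ≤ ‖q ω - γ • (gradf (q ω) + ζ ω) - qstar‖ := by
      refine EuclideanSpace.norm_le_norm_of_abs_le fun i => ?_
      simp only [PiLp.sub_apply (y := qstar), hqplus]
      exact abs_clamp_sub_le _ (hqstar i)
    have hconv : f (q ω) - f qstar ≤ inner ℝ (q ω - qstar) (gradf (q ω)) := by
      rw [hf, hf, hgradf]
      exact half_norm_sq_sub_le_inner A vstar μ _ _
    have hlip : ‖gradf (q ω) - gradf qstar‖ ≤ L * ‖q ω - qstar‖ := by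
      rw [hgradf, hgradf, hL]
      exact norm_quadratic_gradient_sub_le A vstar μ _ _
    have hstep := norm_sq_descent_step_le (ζ ω) hγ hconv hlip
    have hsq := pow_le_pow_left₀ (norm_nonneg _) hproj 2
    simp only [hB, Pi.add_apply, Pi.smul_apply, smul_eq_mul]
    linarith
  have hI_smul := hI_int.smul (-(2 * γ))
  have hN_smul := hN_int.smul (2 * γ ^ 2)
  filter_upwards [condExp_mono (m := G) hint_plus (hB_int.add (hI_smul.add hN_smul))
      (ae_of_all _ hpt),
    condExp_add hB_int (hI_smul.add hN_smul) G, condExp_add hI_smul hN_smul G,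
    condExp_smul (μ := P) (-(2 * γ)) (fun ω' => (inner ℝ (q ω' - qstar) (ζ ω') : ℝ)) G,
    condExp_smul (μ := P) (2 * γ ^ 2) (fun ω' => ‖gradf qstar + ζ ω'‖ ^ 2) G, hI_zero]
    with ω h1 h2 h3 h4 h5 h6
  rw [h2, Pi.add_apply, h3, Pi.add_apply, h4, h5, Pi.smul_apply, Pi.smul_apply, h6,
    condExp_of_stronglyMeasurable hG hB_meas hB_int, Pi.zero_apply, smul_zero, zero_add,
    smul_eq_mul] at h1
  exact h1
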